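/- Let d be a positive integer, let 0 < λ_1 < λ_2 < ⋯, and let a_n ≥ 0 be such that Σ_{n≥1} a_n λ_n^{−σ} < ∞ for every real σ > 1. Then for every complex s with 1 < Re(s) < 2d, ∫_0^∞ ( Σ_{n≥1} a_n log(1 + x^2/λ_n^{2d}) ) x^{−1−s/d} dx = (π d / (s · sin(πs/(2d)))) · Σ_{n≥1} a_n λ_n^{−s}. -/

import Mathlib

open Complex

open Set MeasureTheory Filter Topology

theorem integrable_cpow_mul_exp_neg_prod {z : ℂ} (h0 : 0 < z.re) (h1 : z.re < 1) :
    Integrable (fun p : ℝ × ℝ => (p.2 : ℂ) ^ (z - 1) * cexp (-((1 + p.2) * p.1)))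
      ((volume.restrict (Ioi 0)).prod (volume.restrict (Ioi 0))) := by
  have hmeas : Measurable (fun p : ℝ × ℝ => (p.2 : ℂ) ^ (z - 1) * cexp (-((1 + p.2) * p.1))) := by
    fun_prop
  have hnorm : ∀ y : ℝ, ∀ t ∈ Ioi (0 : ℝ),
      Real.exp (-y) * (t ^ (z.re - 1) * Real.exp (-(y * t))) =
      ‖(t : ℂ) ^ (z - 1) * cexp (-((1 + t) * y))‖ := by
    intro y t ht
    rw [norm_mul, norm_cpow_eq_rpow_re_of_pos ht, norm_exp]
    simp only [sub_re, one_re, neg_re, mul_re, add_re, ofReal_re, add_im, one_im, ofReal_im,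
      mul_zero, sub_zero]
    rw [mul_left_comm, ← Real.exp_add]
    ring_nf
  refine (integrable_prod_iff hmeas.aestronglyMeasurable).2 ⟨?_, ?_⟩
  · refine (ae_restrict_iff' measurableSet_Ioi).2 (ae_of_all _ fun y (hy : 0 < y) => ?_)
    have hm : Measurable (fun t : ℝ => (t : ℂ) ^ (z - 1) * cexp (-((1 + t) * y))) := by fun_prop
    rw [← integrable_norm_iff hm.aestronglyMeasurable]
    have := (integrableOn_rpow_mul_exp_neg_mul_rpow (p := 1) (s := z.re - 1) (b := y)
      (by linarith) one_pos hy).const_mul (Real.exp (-y))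
    refine IntegrableOn.congr_fun this (fun t ht => ?_) measurableSet_Ioi
    simp only [Real.rpow_one, neg_mul]
    exact hnorm y t ht
  · have := (integrableOn_rpow_mul_exp_neg_mul_rpow (p := 1) (s := -z.re) (b := 1)
      (by linarith) one_pos one_pos).const_mul (Real.Gamma z.re)
    refine IntegrableOn.congr_fun this (fun y (hy : 0 < y) => ?_) measurableSet_Ioi
    simp only
    rw [← setIntegral_congr_fun measurableSet_Ioi (hnorm y), integral_const_mul,
      Real.integral_rpow_mul_exp_neg_mul_Ioi h0 hy, one_div, Real.inv_rpow hy.le,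
      Real.rpow_neg hy.le, Real.rpow_one, neg_one_mul]
    ring

/-- The Mellin transform of `t ↦ 1 / (1 + t)` on the strip `0 < Re z < 1`. -/
theorem hasMellin_inv_one_add {z : ℂ} (h0 : 0 < z.re) (h1 : z.re < 1) :
    HasMellin (fun t : ℝ => (1 + t : ℂ)⁻¹) z (Real.pi / sin (Real.pi * z)) := by
  have hint := integrable_cpow_mul_exp_neg_prod h0 h1
  have hinner : ∀ t ∈ Ioi (0 : ℝ),
      ∫ y : ℝ in Ioi 0, (t : ℂ) ^ (z - 1) * cexp (-((1 + t) * y)) =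
        (t : ℂ) ^ (z - 1) • (1 + t : ℂ)⁻¹ := by
    intro t ht
    have ht' : (-(1 + t : ℂ)).re < 0 := by
      have := mem_Ioi.1 ht
      simp; linarith
    have := integral_exp_mul_complex_Ioi ht' 0
    simp only [ofReal_zero, mul_zero, exp_zero, neg_mul, neg_div_neg_eq] at this
    rw [integral_const_mul, this, smul_eq_mul, one_div]
  refine ⟨IntegrableOn.congr_fun (f := fun t : ℝ => _) hint.integral_prod_right hinner
    measurableSet_Ioi, ?_⟩
  rw [mellin, ← setIntegral_congr_fun measurableSet_Ioi hinner,
    ← integral_integral_swap (f := fun (y t : ℝ) => (t : ℂ) ^ (z - 1) * cexp (-((1 + t) * y))) hint,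
    ← Gamma_mul_Gamma_one_sub]
  rw [Gamma_eq_integral (s := 1 - z) (by simpa), GammaIntegral, ← integral_const_mul]
  refine setIntegral_congr_fun measurableSet_Ioi fun y (hy : 0 < y) => ?_
  have hsplit : ∀ t : ℝ, (t : ℂ) ^ (z - 1) * cexp (-((1 + t) * y)) =
      cexp (-y) * ((t : ℂ) ^ (z - 1) * cexp (-(y * t))) := by
    intro t
    rw [mul_left_comm, ← exp_add]
    ring_nf
  simp only [hsplit]
  rw [integral_const_mul, integral_cpow_mul_exp_neg_mul_Ioi h0 hy, one_div,
    inv_cpow _ _ (by rw [arg_ofReal_of_nonneg hy.le]; exact Real.pi_pos.ne), ← cpow_neg]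
  push_cast
  ring_nf

theorem log_one_add_le_rpow_div {t ε : ℝ} (ht : 0 ≤ t) (hε : 0 < ε) (hε1 : ε ≤ 1) :
    Real.log (1 + t) ≤ t ^ ε / ε := by
  rw [le_div_iff₀ hε, mul_comm, ← Real.log_rpow (by positivity)]
  have h2 : (1 + t) ^ ε ≤ 1 + t ^ ε := by
    simpa using Real.rpow_add_le_add_rpow zero_le_one ht hε.le hε1
  have h3 := Real.log_le_sub_one_of_pos (x := (1 + t) ^ ε) (by positivity)
  linarith

theorem mellinConvergent_log_one_add {u : ℂ} (h0 : 0 < u.re) (h1 : u.re < 1) :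
    MellinConvergent (fun t : ℝ => (Real.log (1 + t) : ℂ)) (-u) := by
  have hbound : ∀ ε : ℝ, 0 < ε → ε ≤ 1 → ∀ t : ℝ, 0 < t →
      ‖(Real.log (1 + t) : ℂ)‖ ≤ ε⁻¹ * ‖t ^ (- -ε)‖ := by
    intro ε hε hε1 t ht
    rw [norm_real, Real.norm_of_nonneg (Real.log_nonneg (by linarith)), neg_neg,
      Real.norm_of_nonneg (by positivity), inv_mul_eq_div]
    exact log_one_add_le_rpow_div ht.le hε hε1
  refine mellinConvergent_of_isBigO_rpow (a := -(u.re / 2)) (b := -1) ?_ ?_ ?_ ?_ ?_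
  · refine ContinuousOn.locallyIntegrableOn (fun t ht => ?_) measurableSet_Ioi
    have : 1 + t ≠ 0 := by have := mem_Ioi.1 ht; positivity
    exact ContinuousAt.continuousWithinAt (by fun_prop (disch := assumption))
  · exact .of_bound _ ((eventually_gt_atTop 0).mono (hbound (u.re / 2) (by linarith) (by linarith)))
  · simp; linarith
  · exact .of_bound _ (eventually_nhdsWithin_of_forall (hbound 1 one_pos le_rfl))
  · simpa using h1

/-- The Mellin transform of `t ↦ log (1 + t)` at `-u`, for `0 < Re u < 1`. -/
theorem hasMellin_log_one_add {u : ℂ} (h0 : 0 < u.re) (h1 : u.re < 1) :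
    HasMellin (fun t : ℝ => (Real.log (1 + t) : ℂ)) (-u)
      (Real.pi / (u * sin (Real.pi * u))) := by
  have hlog := mellinConvergent_log_one_add h0 h1
  refine ⟨hlog, ?_⟩
  have hu : u ≠ 0 := by rintro rfl; simp at h0
  obtain ⟨hinv, hinv'⟩ := hasMellin_inv_one_add (z := 1 - u) (by simpa) (by simpa)
  have hsin : sin (Real.pi * (1 - u)) = sin (Real.pi * u) := by
    rw [mul_sub, mul_one, sin_pi_sub]
  rw [hsin] at hinv'
  have hfb : ∀ ε : ℝ, 0 < ε → ε ≤ 1 → ∀ t : ℝ, 0 < t →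
      ‖(t : ℂ) ^ (-u) * (Real.log (1 + t) : ℂ)‖ ≤ t ^ (ε - u.re) / ε := by
    intro ε hε hε1 t ht
    rw [norm_mul, norm_cpow_eq_rpow_re_of_pos ht, norm_real,
      Real.norm_of_nonneg (Real.log_nonneg (by linarith)), sub_eq_neg_add, Real.rpow_add ht,
      mul_div_assoc, neg_re]
    gcongr
    exact log_one_add_le_rpow_div ht.le hε hε1
  have hftc := integral_Ioi_of_hasDerivAt_of_tendsto (a := 0) (m := 0)
    (f := fun t : ℝ => (t : ℂ) ^ (-u) * (Real.log (1 + t) : ℂ))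
    (f' := fun t : ℝ => (t : ℂ) ^ (1 - u - 1) • (1 + t : ℂ)⁻¹
      - u * ((t : ℂ) ^ (-u - 1) • (Real.log (1 + t) : ℂ)))
    ?_ ?_ (hinv.sub (hlog.const_mul u)) ?_
  · rw [integral_sub hinv (hlog.const_mul u), integral_const_mul] at hftc
    change mellin _ _ - u * mellin _ _ = _ at hftc
    rw [hinv'] at hftc
    simp only [add_zero, Real.log_one, ofReal_zero, mul_zero, sub_zero] at hftc
    rw [mul_comm, ← div_div, eq_div_iff hu]
    linear_combination -hftc
  · have hlim : Tendsto (fun t : ℝ => t ^ (1 - u.re) / 1) (𝓝[>] 0) (𝓝 0) := by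
      have : Tendsto (fun t : ℝ => t ^ (1 - u.re)) (𝓝 0) (𝓝 (0 ^ (1 - u.re))) :=
        (Real.continuousAt_rpow_const 0 _ (Or.inr (by linarith))).tendsto
      rw [Real.zero_rpow (by linarith)] at this
      simpa using this.mono_left nhdsWithin_le_nhds
    have : Tendsto (fun t : ℝ => (t : ℂ) ^ (-u) * (Real.log (1 + t) : ℂ)) (𝓝[>] 0) (𝓝 0) :=
      squeeze_zero_norm' (eventually_nhdsWithin_of_forall (hfb 1 one_pos le_rfl)) hlim
    rw [← continuousWithinAt_Ioi_iff_Ici]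
    simpa [ContinuousWithinAt] using this
  · intro t ht
    have ht0 : t ≠ 0 := (mem_Ioi.1 ht).ne'
    have ht1 : 1 + t ≠ 0 := by have := mem_Ioi.1 ht; positivity
    have hd1 : HasDerivAt (fun t : ℝ => (t : ℂ) ^ (-u)) (-u * (t : ℂ) ^ (-u - 1)) t :=
      hasDerivAt_ofReal_cpow_const ht0 (by simpa using hu)
    have hd2 : HasDerivAt (fun t : ℝ => (Real.log (1 + t) : ℂ)) (((1 + t)⁻¹ : ℝ) : ℂ) t := by
      have := ((hasDerivAt_id t).const_add 1).log ht1
      simpa using this.ofReal_comp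
    refine (hd1.mul hd2).congr_deriv ?_
    push_cast
    rw [show 1 - u - 1 = -u by ring]
    simp only [smul_eq_mul]
    ring
  · have hlim : Tendsto (fun t : ℝ => t ^ (u.re / 2 - u.re) / (u.re / 2)) atTop (𝓝 0) := by
      have := (tendsto_rpow_neg_atTop (y := u.re / 2) (by linarith)).div_const (u.re / 2)
      rw [zero_div] at this
      convert this using 4
      ring
    exact squeeze_zero_norm' ((eventually_gt_atTop 0).mono
      (hfb (u.re / 2) (by linarith) (by linarith))) hlim

/-- The Mellin transform of `x ↦ log (1 + x ^ 2 / l ^ (2 * d))`, evaluated at `-s / d`. -/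
theorem hasMellin_log_one_add_sq_div {d : ℕ} (hd : 0 < d) {l : ℝ} (hl : 0 < l) {s : ℂ}
    (h0 : 0 < s.re) (h1 : s.re < 2 * d) :
    HasMellin (fun x : ℝ => (Real.log (1 + x ^ 2 / l ^ (2 * d)) : ℂ)) (-(s / d))
      ((Real.pi : ℂ) * d / (s * sin (Real.pi * s / (2 * d))) / (l : ℂ) ^ s) := by
  have hd0 : (0 : ℝ) < d := Nat.cast_pos.2 hd
  have hdc : (d : ℂ) ≠ 0 := Nat.cast_ne_zero.2 hd.ne'
  have hre : (s / (2 * d)).re = s.re / (2 * d) := by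
    rw [show (2 * d : ℂ) = ((2 * d : ℝ) : ℂ) by push_cast; rfl, div_ofReal_re]
  obtain ⟨hc, hm⟩ := hasMellin_log_one_add (u := s / (2 * d)) (by rw [hre]; positivity)
    (by rw [hre, div_lt_one (by positivity)]; exact h1)
  have hl' : 0 < (l ^ (2 * d))⁻¹ := by positivity
  have harg : -(s / d) / ((2 : ℝ) : ℂ) = -(s / (2 * d)) := by
    push_cast
    field_simp
  have hfun : (fun x : ℝ => (Real.log (1 + x ^ 2 / l ^ (2 * d)) : ℂ)) =
      fun x : ℝ => (fun t : ℝ => (Real.log (1 + (l ^ (2 * d))⁻¹ * t) : ℂ)) (x ^ (2 : ℝ)) := by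
    funext x
    simp only [Real.rpow_two, div_eq_inv_mul]
  have hpow : (((l ^ (2 * d))⁻¹ : ℝ) : ℂ) ^ (s / (2 * d)) = ((l : ℂ) ^ s)⁻¹ := by
    rw [← cpow_neg, ← Real.rpow_natCast, ← Real.rpow_neg hl.le, ← cpow_mul_ofReal_nonneg hl.le]
    congr 1
    push_cast
    field_simp
  rw [hfun]
  constructor
  · rw [MellinConvergent.comp_rpow
      (f := fun t : ℝ => (Real.log (1 + (l ^ (2 * d))⁻¹ * t) : ℂ)) two_ne_zero, harg]
    exact (MellinConvergent.comp_mul_left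
      (f := fun t : ℝ => (Real.log (1 + t) : ℂ)) hl').2 hc
  · rw [mellin_comp_rpow (fun t : ℝ => (Real.log (1 + (l ^ (2 * d))⁻¹ * t) : ℂ)), harg,
      mellin_comp_mul_left (fun t : ℝ => (Real.log (1 + t) : ℂ)) _ hl', hm, neg_neg, hpow,
      abs_of_pos two_pos, real_smul, smul_eq_mul, mul_div_assoc (Real.pi : ℂ) s]
    push_cast
    simp only [div_eq_mul_inv, mul_inv, inv_inv]
    ring

/-- Mellin-transform identity for a general Dirichlet series: for `1 < Re(s) < 2d`,
`∫_0^∞ (Σ_n a_n log(1 + x²/λ_n^{2d})) x^{-1-s/d} dx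
  = (πd/(s sin(πs/(2d)))) Σ_n a_n λ_n^{-s}`. -/
theorem mellin_identity_general_dirichlet
    (d : ℕ) (hd : 0 < d) (lam : ℕ → ℝ) (hlam : StrictMono lam) (hlam0 : 0 < lam 0)
    (a : ℕ → ℝ) (ha : ∀ n, 0 ≤ a n)
    (hconv : ∀ σ : ℝ, 1 < σ → Summable fun n => a n / lam n ^ σ)
    (s : ℂ) (h1 : 1 < s.re) (h2 : s.re < 2 * d) :
    ∫ x : ℝ in Set.Ioi (0 : ℝ),
        ((∑' n : ℕ, a n * Real.log (1 + x ^ 2 / lam n ^ (2 * d)) : ℝ) : ℂ) *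
          (x : ℂ) ^ (-1 - s / d) =
      ((Real.pi : ℂ) * d / (s * Complex.sin (Real.pi * s / (2 * d)))) *
        ∑' n : ℕ, (a n : ℂ) / (lam n : ℂ) ^ s := by
  have hpos : ∀ n, 0 < lam n := fun n => hlam0.trans_le (hlam.monotone n.zero_le)
  have hM := fun n => hasMellin_log_one_add_sq_div hd (hpos n) (zero_lt_one.trans h1) h2
  have hMre := fun n => hasMellin_log_one_add_sq_div (s := (s.re : ℂ)) hd (hpos n)
    (by simpa using zero_lt_one.trans h1) (by simpa using h2)
  set F : ℕ → ℝ → ℂ := fun n x => (a n : ℂ) *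
    ((x : ℂ) ^ (-(s / d) - 1) • (Real.log (1 + x ^ 2 / lam n ^ (2 * d)) : ℂ)) with hF
  have hint : ∀ n, IntegrableOn (F n) (Ioi 0) := fun n => (hM n).1.const_mul _
  have hnorm : ∀ n, ((∫ x in Ioi (0 : ℝ), ‖F n x‖ : ℝ) : ℂ) =
      (Real.pi : ℂ) * d / (s.re * sin (Real.pi * s.re / (2 * d))) *
        ((a n / lam n ^ s.re : ℝ) : ℂ) := by
    intro n
    have key : ∀ x ∈ Ioi (0 : ℝ), ((‖F n x‖ : ℝ) : ℂ) = (a n : ℂ) *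
        ((x : ℂ) ^ (-((s.re : ℂ) / d) - 1) •
          (Real.log (1 + x ^ 2 / lam n ^ (2 * d)) : ℂ)) := by
      intro x hx
      have hx' : 0 < x := hx
      have hlog : 0 ≤ Real.log (1 + x ^ 2 / lam n ^ (2 * d)) := by
        have := hpos n
        exact Real.log_nonneg (le_add_of_nonneg_right (by positivity))
      rw [hF]
      simp only [smul_eq_mul]
      rw [norm_mul, norm_mul, norm_real, norm_real, Real.norm_of_nonneg (ha n),
        Real.norm_of_nonneg hlog, norm_cpow_eq_rpow_re_of_pos hx']
      push_cast [ofReal_cpow hx'.le]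
      simp
    rw [← integral_complex_ofReal]
    refine (setIntegral_congr_fun measurableSet_Ioi key).trans ?_
    rw [integral_const_mul]
    change _ * mellin _ _ = _
    rw [(hMre n).2]
    push_cast [ofReal_cpow (hpos n).le]
    ring
  have hsummable : Summable fun n => ∫ x in Ioi (0 : ℝ), ‖F n x‖ := by
    rw [← summable_ofReal]
    simp only [hnorm]
    exact (summable_ofReal.2 (hconv _ h1)).mul_left _
  have hswap := integral_tsum_of_summable_integral_norm hint hsummable
  rw [← tsum_mul_left]
  refine Eq.trans (setIntegral_congr_fun measurableSet_Ioi fun x _ => ?_)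
    (hswap.symm.trans (tsum_congr fun n => ?_))
  · simp only [hF, smul_eq_mul]
    rw [ofReal_tsum, ← tsum_mul_right]
    refine tsum_congr fun n => ?_
    rw [show -1 - s / d = -(s / d) - 1 by ring]
    push_cast
    ring
  · rw [hF, integral_const_mul]
    change _ * mellin _ _ = _
    rw [(hM n).2]
    ring
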